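/- Existence of a smooth source term with vanishing component integrals: Let X ⊂ ℝⁿ be an open bounded set whose collection of connected components is finite, say X = X₁ ⊔ … ⊔ X_Ω with each X_i open and nonempty. Then there exists a smooth function φ ∈ C^∞(ℝⁿ) such that φ(x) = 1 for all x ∈ ℝⁿ ∖ X, φ(x) ≤ 1 for all x ∈ ℝⁿ, and ∫_{X_i} φ dλ = 0 for every i ∈ {1,…,Ω}, where λ denotes Lebesgue measure on ℝⁿ. -/

import Mathlib

open MeasureTheory

/-- **Existence of a smooth source term with vanishing component integrals.** -/
theorem exists_smooth_source_term
    {n : ℕ} (X : Set (Fin n → ℝ)) (hXopen : IsOpen X)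
    (hXbdd : Bornology.IsBounded X)
    (Ω : ℕ) (Xc : Fin Ω → Set (Fin n → ℝ))
    (hXcopen : ∀ i, IsOpen (Xc i))
    (hXcne : ∀ i, (Xc i).Nonempty)
    (hXcconn : ∀ i, IsConnected (Xc i))
    (hXcdisj : Pairwise (Function.onFun Disjoint Xc))
    (hXunion : X = ⋃ i, Xc i) :
    ∃ φ : (Fin n → ℝ) → ℝ, ContDiff ℝ (⊤ : ℕ∞) φ ∧
      (∀ x ∉ X, φ x = 1) ∧ (∀ x, φ x ≤ 1) ∧
      ∀ i, (∫ x in Xc i, φ x) = 0 := by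
  have hg : ∀ i, ∃ g : (Fin n → ℝ) → ℝ, ContDiff ℝ (⊤ : ℕ∞) g ∧ (∀ x, 0 ≤ g x) ∧
      (∀ x ∉ Xc i, g x = 0) ∧ Integrable g ∧ ∫ x, g x = 1 := by
    intro i
    obtain ⟨c, hc⟩ := hXcne i
    obtain ⟨r, hr, hball⟩ := Metric.isOpen_iff.1 (hXcopen i) c hc
    let f : ContDiffBump c := ⟨r / 2, r, by positivity, by linarith⟩
    refine ⟨f.normed volume, f.contDiff_normed, f.nonneg_normed, ?_, f.integrable_normed,
      f.integral_normed⟩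
    intro x hx
    by_contra h
    have h2 : x ∈ Function.support (f.normed volume) := h
    rw [f.support_normed_eq] at h2
    exact hx (hball h2)
  choose g hgs hg0 hgz hgi hg1 using hg
  have hsub : ∀ i, Xc i ⊆ X := fun i => hXunion ▸ Set.subset_iUnion Xc i
  refine ⟨fun x => 1 - ∑ i, volume.real (Xc i) * g i x, ?_, ?_, ?_, ?_⟩
  · exact contDiff_const.sub (ContDiff.sum fun i _ => contDiff_const.mul (hgs i))
  · intro x hx
    have : ∑ i, volume.real (Xc i) * g i x = 0 :=
      Finset.sum_eq_zero fun i _ => by rw [hgz i x (fun h => hx (hsub i h)), mul_zero]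
    simp [this]
  · intro x
    have : 0 ≤ ∑ i, volume.real (Xc i) * g i x :=
      Finset.sum_nonneg fun i _ => mul_nonneg measureReal_nonneg (hg0 i x)
    linarith
  · intro i
    have hfin : volume (Xc i) < ⊤ := (hXbdd.subset (hsub i)).measure_lt_top
    have h1 : ∫ x in Xc i, (1 - ∑ j, volume.real (Xc j) * g j x)
        = ∫ x in Xc i, (1 - volume.real (Xc i) * g i x) := by
      refine setIntegral_congr_fun (hXcopen i).measurableSet fun x hx => ?_
      have : ∑ j, volume.real (Xc j) * g j x = volume.real (Xc i) * g i x := by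
        refine Finset.sum_eq_single i (fun j _ hj => ?_) (by simp)
        rw [hgz j x (fun h => Set.disjoint_left.1 (hXcdisj hj) h hx), mul_zero]
      simp only [this]
    have h2 : ∫ x in Xc i, g i x = 1 := by
      rw [setIntegral_eq_integral_of_forall_compl_eq_zero (hgz i), hg1]
    have h3 : Integrable (fun _ : Fin n → ℝ => (1 : ℝ)) (volume.restrict (Xc i)) :=
      integrableOn_const hfin.ne
    have h4 : Integrable (fun x => volume.real (Xc i) * g i x) (volume.restrict (Xc i)) :=
      ((hgi i).restrict).const_mul _
    rw [h1, integral_sub h3 h4,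
      integral_const_mul, h2]
    simp
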